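/- In R = ℂ[x, y, z], let J = (y² − x·z, x³ − y·z, x²·y − z²) and I = (z² − x²·y, x⁴ + y³ − 2·x·y·z). Then for every g ∈ R: g ∈ J if and only if (x³ − y·z)·g ∈ I and (y² − x·z)·g ∈ I. -/

import Mathlib

open MvPolynomial

/-- The parametrization `t ↦ (t³, t⁴, t⁵)` of the monomial curve, on coordinate rings. -/
noncomputable def monomialCurveHom : MvPolynomial (Fin 3) ℂ →ₐ[ℂ] Polynomial ℂ :=
  aeval ![Polynomial.X ^ 3, Polynomial.X ^ 4, Polynomial.X ^ 5]

@[simp] lemma monomialCurveHom_X_zero : monomialCurveHom (X 0) = Polynomial.X ^ 3 := by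
  simp [monomialCurveHom]

@[simp] lemma monomialCurveHom_X_one : monomialCurveHom (X 1) = Polynomial.X ^ 4 := by
  simp [monomialCurveHom]

@[simp] lemma monomialCurveHom_X_two : monomialCurveHom (X 2) = Polynomial.X ^ 5 := by
  simp [monomialCurveHom]

/-- The ideal of `2 × 2` minors defining the monomial curve `(t³, t⁴, t⁵)`. -/
noncomputable abbrev monomialCurveIdeal : Ideal (MvPolynomial (Fin 3) ℂ) :=
  Ideal.span {(X 1 : MvPolynomial (Fin 3) ℂ) ^ 2 - X 0 * X 2,
    X 0 ^ 3 - X 1 * X 2, X 0 ^ 2 * X 1 - X 2 ^ 2}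

lemma mem_span_triple {R : Type*} [CommRing R] {a b c g : R} :
    g ∈ Ideal.span {a, b, c} ↔ ∃ u v w, u * a + v * b + w * c = g := by
  simp only [Ideal.mem_span_insert, Ideal.mem_span_singleton', ↓existsAndEq, true_and]
  constructor
  · rintro ⟨u, v, w, h⟩
    exact ⟨u, v, w, by rw [h]; ring⟩
  · rintro ⟨u, v, w, h⟩
    exact ⟨u, v, w, by rw [← h]; ring⟩

/-- Modulo the ideal of the curve, `1, y, z` generate the polynomial ring over `ℂ[x]`. -/
lemma exists_normalForm (g : MvPolynomial (Fin 3) ℂ) :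
    ∃ p q r : Polynomial ℂ,
      g - (p.aeval (X 0) + X 1 * q.aeval (X 0) + X 2 * r.aeval (X 0)) ∈ monomialCurveIdeal := by
  induction g using MvPolynomial.induction_on with
  | C a => exact ⟨Polynomial.C a, 0, 0, by simp [MvPolynomial.algebraMap_eq]⟩
  | add f g hf hg =>
    obtain ⟨p, q, r, h⟩ := hf
    obtain ⟨p', q', r', h'⟩ := hg
    refine ⟨p + p', q + q', r + r', ?_⟩
    convert Ideal.add_mem _ h h' using 1
    simp only [map_add]
    ring
  | mul_X f i hf =>
    obtain ⟨p, q, r, h⟩ := hf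
    obtain ⟨u, v, w, h⟩ := mem_span_triple.1 h
    simp only [mem_span_triple]
    fin_cases i
    · refine ⟨Polynomial.X * p, Polynomial.X * q, Polynomial.X * r,
        u * X 0, v * X 0, w * X 0, ?_⟩
      simp only [map_mul, Polynomial.aeval_X, Fin.zero_eta]
      linear_combination X 0 * h
    · refine ⟨Polynomial.X ^ 3 * r, p, Polynomial.X * q,
        u * X 1 + q.aeval (X 0), v * X 1 - r.aeval (X 0), w * X 1, ?_⟩
      simp only [map_mul, map_pow, Polynomial.aeval_X, Fin.mk_one]
      linear_combination X 1 * h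
    · refine ⟨Polynomial.X ^ 3 * q, Polynomial.X ^ 2 * r, p,
        u * X 2, v * X 2 - q.aeval (X 0), w * X 2 - r.aeval (X 0), ?_⟩
      simp only [map_mul, map_pow, Polynomial.aeval_X, Fin.reduceFinMk]
      linear_combination X 2 * h

lemma eq_zero_of_expand_three_add {p q r : Polynomial ℂ}
    (h : Polynomial.expand ℂ 3 p + Polynomial.X ^ 4 * Polynomial.expand ℂ 3 q +
      Polynomial.X ^ 5 * Polynomial.expand ℂ 3 r = 0) : p = 0 ∧ q = 0 ∧ r = 0 := by
  have key (n : ℕ) := congrArg (fun f => Polynomial.coeff f n) h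
  simp only [Polynomial.coeff_add, Polynomial.coeff_X_pow_mul', Polynomial.coeff_zero,
    Polynomial.coeff_expand (show 0 < 3 by norm_num)] at key
  refine ⟨?_, ?_, ?_⟩ <;> ext n
  · have := key (3 * n)
    grind [Polynomial.coeff_zero]
  · have := key (3 * n + 4)
    grind [Polynomial.coeff_zero]
  · have := key (3 * n + 5)
    grind [Polynomial.coeff_zero]

lemma monomialCurveHom_aeval_X_zero (p : Polynomial ℂ) :
    monomialCurveHom (p.aeval (X 0)) = Polynomial.expand ℂ 3 p := by
  rw [← Polynomial.aeval_algHom_apply, monomialCurveHom_X_zero]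
  rfl

lemma mem_monomialCurveIdeal_of_map_eq_zero {g : MvPolynomial (Fin 3) ℂ}
    (hg : monomialCurveHom g = 0) : g ∈ monomialCurveIdeal := by
  obtain ⟨p, q, r, h⟩ := exists_normalForm g
  have hle : monomialCurveIdeal ≤ RingHom.ker monomialCurveHom := by
    rw [Ideal.span_le]
    rintro f (rfl | rfl | rfl) <;> simp [RingHom.mem_ker] <;> ring
  have hzero := hle h
  simp only [RingHom.mem_ker, map_sub, map_add, map_mul, hg, monomialCurveHom_aeval_X_zero,
    monomialCurveHom_X_one, monomialCurveHom_X_two, zero_sub, neg_eq_zero] at hzero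
  obtain ⟨rfl, rfl, rfl⟩ := eq_zero_of_expand_three_add hzero
  simpa using h

/-- The gradients of the two equations are parallel along the curve, while that of `y² - xz` is
independent of them; so `(y² - xz) * g` can lie in the ideal only if `g` vanishes on the curve. -/
lemma monomialCurveHom_eq_zero_of_mul_mem {g : MvPolynomial (Fin 3) ℂ}
    (hg : ((X 1 : MvPolynomial (Fin 3) ℂ) ^ 2 - X 0 * X 2) * g ∈
      Ideal.span {(X 2 : MvPolynomial (Fin 3) ℂ) ^ 2 - X 0 ^ 2 * X 1,
        X 0 ^ 4 + X 1 ^ 3 - 2 * X 0 * X 1 * X 2}) : monomialCurveHom g = 0 := by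
  obtain ⟨u, v, h⟩ := Ideal.mem_span_pair.1 hg
  have htwo (i : Fin 3) : pderiv i (2 : MvPolynomial (Fin 3) ℂ) = 0 :=
    mod_cast (pderiv i).map_natCast 2
  have hx := congrArg (fun f => monomialCurveHom (pderiv 0 f)) h
  have hy := congrArg (fun f => monomialCurveHom (pderiv 1 f)) h
  simp [Derivation.leibniz, Derivation.leibniz_pow, pderiv_X, htwo, map_ofNat] at hx hy
  have : (5 * Polynomial.X ^ 5 : Polynomial ℂ) * monomialCurveHom g = 0 := by
    linear_combination hx - 2 * Polynomial.X * hy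
  simpa using this

/-- **Membership criterion of Example 2.5 of the paper.** In `R = ℂ[x, y, z]`,
with `J = (y² − xz, x³ − yz, x²y − z²)` and `I = (z² − x²y, x⁴ + y³ − 2xyz)`,
one has `g ∈ J` if and only if `(x³ − yz)·g ∈ I` and `(y² − xz)·g ∈ I`. -/
theorem mem_monomial_curve_ideal_iff (g : MvPolynomial (Fin 3) ℂ) :
    g ∈ Ideal.span {(X 1 : MvPolynomial (Fin 3) ℂ) ^ 2 - X 0 * X 2,
        X 0 ^ 3 - X 1 * X 2, X 0 ^ 2 * X 1 - X 2 ^ 2} ↔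
      ((X 0 : MvPolynomial (Fin 3) ℂ) ^ 3 - X 1 * X 2) * g ∈
          Ideal.span {(X 2 : MvPolynomial (Fin 3) ℂ) ^ 2 - X 0 ^ 2 * X 1,
            X 0 ^ 4 + X 1 ^ 3 - 2 * X 0 * X 1 * X 2} ∧
        ((X 1 : MvPolynomial (Fin 3) ℂ) ^ 2 - X 0 * X 2) * g ∈
          Ideal.span {(X 2 : MvPolynomial (Fin 3) ℂ) ^ 2 - X 0 ^ 2 * X 1,
            X 0 ^ 4 + X 1 ^ 3 - 2 * X 0 * X 1 * X 2} := by
  refine ⟨fun hg => ?_, fun hg => mem_monomialCurveIdeal_of_map_eq_zero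
    (monomialCurveHom_eq_zero_of_mul_mem hg.2)⟩
  obtain ⟨u, v, w, rfl⟩ := mem_span_triple.1 hg
  simp only [Ideal.mem_span_pair]
  exact ⟨⟨-X 0 * X 1 * u + X 1 ^ 2 * v - w * (X 0 ^ 3 - X 1 * X 2),
      -X 2 * u + X 0 ^ 2 * v, by ring⟩,
    ⟨X 0 ^ 2 * u - X 0 * X 1 * v - w * (X 1 ^ 2 - X 0 * X 2), X 1 * u - X 2 * v, by ring⟩⟩
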